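/- For n = 2, m = 1, on the open set of ℝ⁴ where u₁ ≠ u₂ and p₁ ≠ 0, define a = p₁²/(4(u₁−u₂)) + p₂²/(u₂−u₁) − u₁² − u₁u₂ − u₂², and construct the abscissa x₃ of the point [2]P₁ + P₂ on the cubic y² = x³ + a·x + b by the tangent–chord process: λ₁ = (3u₁² + a)/p₁, x' = λ₁² − 2u₁, y' = −(p₁/2 + λ₁(x' − u₁)), and (assuming x' ≠ u₂) λ₂ = (y' − p₂)/(x' − u₂), x₃ = λ₂² − x' − u₂. Then {a, x₃} = 0 with respect to the canonical Poisson bracket; i.e. x₃ is an additional first integral of the Hamiltonian system with Hamiltonian H = a. -/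

import Mathlib

/-- The canonical Poisson bracket on `ℝ⁴` with coordinates `(u₁,u₂,p₁,p₂)`. -/
noncomputable def poissonBracket (f g : ℝ → ℝ → ℝ → ℝ → ℝ) (u₁ u₂ p₁ p₂ : ℝ) : ℝ :=
    deriv (fun x => f x u₂ p₁ p₂) u₁ * deriv (fun y => g u₁ u₂ y p₂) p₁
  + deriv (fun x => f u₁ x p₁ p₂) u₂ * deriv (fun y => g u₁ u₂ p₁ y) p₂
  - deriv (fun y => f u₁ u₂ y p₂) p₁ * deriv (fun x => g x u₂ p₁ p₂) u₁
  - deriv (fun y => f u₁ u₂ p₁ y) p₂ * deriv (fun x => g u₁ x p₁ p₂) u₂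

/-- Hamiltonian `a` for `n = 2`, `m = 1`. -/
noncomputable def aFun (x₁ x₂ y₁ y₂ : ℝ) : ℝ :=
  y₁ ^ 2 / (4 * (x₁ - x₂)) + y₂ ^ 2 / (x₂ - x₁) - x₁ ^ 2 - x₁ * x₂ - x₂ ^ 2

/-- Slope of the tangent line at `P₁ = (u₁, p₁/2)`. -/
noncomputable def lam₁Fun (x₁ x₂ y₁ y₂ : ℝ) : ℝ :=
  (3 * x₁ ^ 2 + aFun x₁ x₂ y₁ y₂) / y₁

/-- Abscissa of `[2]P₁` (tangent process). -/
noncomputable def x'Fun (x₁ x₂ y₁ y₂ : ℝ) : ℝ :=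
  (lam₁Fun x₁ x₂ y₁ y₂) ^ 2 - 2 * x₁

/-- Ordinate of `[2]P₁` (tangent process). -/
noncomputable def y'Fun (x₁ x₂ y₁ y₂ : ℝ) : ℝ :=
  -(y₁ / 2 + lam₁Fun x₁ x₂ y₁ y₂ * (x'Fun x₁ x₂ y₁ y₂ - x₁))

/-- Slope of the chord through `[2]P₁` and `P₂ = (u₂, p₂)`. -/
noncomputable def lam₂Fun (x₁ x₂ y₁ y₂ : ℝ) : ℝ :=
  (y'Fun x₁ x₂ y₁ y₂ - y₂) / (x'Fun x₁ x₂ y₁ y₂ - x₂)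

/-- Abscissa of `[2]P₁ + P₂` (chord process). -/
noncomputable def x₃Fun (x₁ x₂ y₁ y₂ : ℝ) : ℝ :=
  (lam₂Fun x₁ x₂ y₁ y₂) ^ 2 - x'Fun x₁ x₂ y₁ y₂ - x₂

/-- All four partial derivatives of `g` exist at the given point, and the Poisson bracket
`{f, g}` equals `d` there. -/
def HasPoissonBracket (f g : ℝ → ℝ → ℝ → ℝ → ℝ) (d u₁ u₂ p₁ p₂ : ℝ) : Prop :=
  DifferentiableAt ℝ (fun x => g x u₂ p₁ p₂) u₁ ∧
  DifferentiableAt ℝ (fun x => g u₁ x p₁ p₂) u₂ ∧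
  DifferentiableAt ℝ (fun y => g u₁ u₂ y p₂) p₁ ∧
  DifferentiableAt ℝ (fun y => g u₁ u₂ p₁ y) p₂ ∧
  poissonBracket f g u₁ u₂ p₁ p₂ = d

namespace HasPoissonBracket

variable {f g h : ℝ → ℝ → ℝ → ℝ → ℝ} {d e u₁ u₂ p₁ p₂ : ℝ}

theorem congr_value (hg : HasPoissonBracket f g d u₁ u₂ p₁ p₂) (hd : d = e) :
    HasPoissonBracket f g e u₁ u₂ p₁ p₂ := hd ▸ hg

theorem const (c : ℝ) : HasPoissonBracket f (fun _ _ _ _ => c) 0 u₁ u₂ p₁ p₂ := by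
  refine ⟨by fun_prop, by fun_prop, by fun_prop, by fun_prop, ?_⟩
  simp [poissonBracket]

theorem add (hg : HasPoissonBracket f g d u₁ u₂ p₁ p₂)
    (hh : HasPoissonBracket f h e u₁ u₂ p₁ p₂) :
    HasPoissonBracket f (fun a b c k => g a b c k + h a b c k) (d + e) u₁ u₂ p₁ p₂ := by
  obtain ⟨g₁, g₂, g₃, g₄, rfl⟩ := hg
  obtain ⟨h₁, h₂, h₃, h₄, rfl⟩ := hh
  refine ⟨g₁.add h₁, g₂.add h₂, g₃.add h₃, g₄.add h₄, ?_⟩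
  simp only [poissonBracket, deriv_fun_add g₁ h₁, deriv_fun_add g₂ h₂, deriv_fun_add g₃ h₃,
    deriv_fun_add g₄ h₄]
  ring

theorem mul (hg : HasPoissonBracket f g d u₁ u₂ p₁ p₂)
    (hh : HasPoissonBracket f h e u₁ u₂ p₁ p₂) :
    HasPoissonBracket f (fun a b c k => g a b c k * h a b c k)
      (d * h u₁ u₂ p₁ p₂ + g u₁ u₂ p₁ p₂ * e) u₁ u₂ p₁ p₂ := by
  obtain ⟨g₁, g₂, g₃, g₄, rfl⟩ := hg
  obtain ⟨h₁, h₂, h₃, h₄, rfl⟩ := hh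
  refine ⟨g₁.mul h₁, g₂.mul h₂, g₃.mul h₃, g₄.mul h₄, ?_⟩
  simp only [poissonBracket, deriv_fun_mul g₁ h₁, deriv_fun_mul g₂ h₂, deriv_fun_mul g₃ h₃,
    deriv_fun_mul g₄ h₄]
  ring

theorem neg (hg : HasPoissonBracket f g d u₁ u₂ p₁ p₂) :
    HasPoissonBracket f (fun a b c k => -g a b c k) (-d) u₁ u₂ p₁ p₂ := by
  simpa using (const (-1)).mul hg

theorem sub (hg : HasPoissonBracket f g d u₁ u₂ p₁ p₂)
    (hh : HasPoissonBracket f h e u₁ u₂ p₁ p₂) :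
    HasPoissonBracket f (fun a b c k => g a b c k - h a b c k) (d - e) u₁ u₂ p₁ p₂ := by
  simpa only [sub_eq_add_neg] using hg.add hh.neg

theorem sq (hg : HasPoissonBracket f g d u₁ u₂ p₁ p₂) :
    HasPoissonBracket f (fun a b c k => g a b c k ^ 2)
      (2 * g u₁ u₂ p₁ p₂ * d) u₁ u₂ p₁ p₂ := by
  simp only [pow_two]
  exact (hg.mul hg).congr_value (by ring)

theorem div (hg : HasPoissonBracket f g d u₁ u₂ p₁ p₂)
    (hh : HasPoissonBracket f h e u₁ u₂ p₁ p₂) (h0 : h u₁ u₂ p₁ p₂ ≠ 0) :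
    HasPoissonBracket f (fun a b c k => g a b c k / h a b c k)
      ((d - g u₁ u₂ p₁ p₂ / h u₁ u₂ p₁ p₂ * e) / h u₁ u₂ p₁ p₂) u₁ u₂ p₁ p₂ := by
  obtain ⟨g₁, g₂, g₃, g₄, rfl⟩ := hg
  obtain ⟨h₁, h₂, h₃, h₄, rfl⟩ := hh
  refine ⟨g₁.div h₁ h0, g₂.div h₂ h0, g₃.div h₃ h0, g₄.div h₄ h0, ?_⟩
  simp only [poissonBracket, deriv_fun_div g₁ h₁ h0, deriv_fun_div g₂ h₂ h0,
    deriv_fun_div g₃ h₃ h0, deriv_fun_div g₄ h₄ h0]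
  field_simp
  ring

end HasPoissonBracket

section aFun

variable {u₁ u₂ : ℝ} (p₁ p₂ : ℝ)

theorem hasDerivAt_aFun_u₁ (h : u₁ ≠ u₂) :
    HasDerivAt (fun x => aFun x u₂ p₁ p₂)
      ((3 * u₁ ^ 2 + aFun u₁ u₂ p₁ p₂) / (u₂ - u₁)) u₁ := by
  have h₁ : u₁ - u₂ ≠ 0 := sub_ne_zero.2 h
  have h₂ : u₂ - u₁ ≠ 0 := sub_ne_zero.2 h.symm
  have hx := hasDerivAt_id' u₁
  have key := (((((hasDerivAt_const u₁ (p₁ ^ 2)).fun_div ((hx.sub_const u₂).const_mul 4)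
    (mul_ne_zero four_ne_zero h₁)).fun_add ((hasDerivAt_const u₁ (p₂ ^ 2)).fun_div
    (hx.const_sub u₂) h₂)).fun_sub (hx.fun_pow 2)).fun_sub (hx.mul_const u₂)).sub_const (u₂ ^ 2)
  refine key.congr_deriv ?_
  rw [aFun, ← neg_sub u₁ u₂]
  field_simp
  ring

theorem hasDerivAt_aFun_u₂ (h : u₁ ≠ u₂) :
    HasDerivAt (fun x => aFun u₁ x p₁ p₂)
      (-((3 * u₂ ^ 2 + aFun u₁ u₂ p₁ p₂) / (u₂ - u₁))) u₂ := by
  have h₁ : u₁ - u₂ ≠ 0 := sub_ne_zero.2 h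
  have h₂ : u₂ - u₁ ≠ 0 := sub_ne_zero.2 h.symm
  have hx := hasDerivAt_id' u₂
  have key := (((((hasDerivAt_const u₂ (p₁ ^ 2)).fun_div ((hx.const_sub u₁).const_mul 4)
    (mul_ne_zero four_ne_zero h₁)).fun_add ((hasDerivAt_const u₂ (p₂ ^ 2)).fun_div
    (hx.sub_const u₁) h₂)).sub_const (u₁ ^ 2)).fun_sub (hx.const_mul u₁)).fun_sub (hx.fun_pow 2)
  refine key.congr_deriv ?_
  rw [aFun, ← neg_sub u₁ u₂]
  field_simp
  ring

theorem hasDerivAt_aFun_p₁ (h : u₁ ≠ u₂) :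
    HasDerivAt (fun y => aFun u₁ u₂ y p₂) (-(p₁ / 2 / (u₂ - u₁))) p₁ := by
  have h₁ : u₁ - u₂ ≠ 0 := sub_ne_zero.2 h
  have key := ((((((hasDerivAt_id' p₁).fun_pow 2).div_const (4 * (u₁ - u₂))).add_const
    (p₂ ^ 2 / (u₂ - u₁))).sub_const (u₁ ^ 2)).sub_const (u₁ * u₂)).sub_const (u₂ ^ 2)
  refine key.congr_deriv ?_
  rw [← neg_sub u₁ u₂]
  field_simp
  ring

theorem hasDerivAt_aFun_p₂ :
    HasDerivAt (fun y => aFun u₁ u₂ p₁ y) (2 * p₂ / (u₂ - u₁)) p₂ := by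
  have key := ((((((hasDerivAt_id' p₂).fun_pow 2).div_const (u₂ - u₁)).const_add
    (p₁ ^ 2 / (4 * (u₁ - u₂)))).sub_const (u₁ ^ 2)).sub_const (u₁ * u₂)).sub_const (u₂ ^ 2)
  exact key.congr_deriv (by simp)

theorem hasPoissonBracket_aFun_self (h : u₁ ≠ u₂) :
    HasPoissonBracket aFun aFun 0 u₁ u₂ p₁ p₂ :=
  ⟨(hasDerivAt_aFun_u₁ p₁ p₂ h).differentiableAt, (hasDerivAt_aFun_u₂ p₁ p₂ h).differentiableAt,
    (hasDerivAt_aFun_p₁ p₁ p₂ h).differentiableAt, (hasDerivAt_aFun_p₂ p₁ p₂).differentiableAt,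
    by simp only [poissonBracket]; ring⟩

theorem hasPoissonBracket_aFun_u₁ (h : u₁ ≠ u₂) :
    HasPoissonBracket aFun (fun x _ _ _ => x) (p₁ / 2 / (u₂ - u₁)) u₁ u₂ p₁ p₂ := by
  refine ⟨by fun_prop, by fun_prop, by fun_prop, by fun_prop, ?_⟩
  simp [poissonBracket, (hasDerivAt_aFun_p₁ p₁ p₂ h).deriv]

theorem hasPoissonBracket_aFun_u₂ :
    HasPoissonBracket aFun (fun _ x _ _ => x) (-(2 * p₂ / (u₂ - u₁))) u₁ u₂ p₁ p₂ := by
  refine ⟨by fun_prop, by fun_prop, by fun_prop, by fun_prop, ?_⟩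
  simp [poissonBracket, (hasDerivAt_aFun_p₂ p₁ p₂).deriv]

theorem hasPoissonBracket_aFun_p₁ (h : u₁ ≠ u₂) :
    HasPoissonBracket aFun (fun _ _ y _ => y)
      ((3 * u₁ ^ 2 + aFun u₁ u₂ p₁ p₂) / (u₂ - u₁)) u₁ u₂ p₁ p₂ := by
  refine ⟨by fun_prop, by fun_prop, by fun_prop, by fun_prop, ?_⟩
  simp [poissonBracket, (hasDerivAt_aFun_u₁ p₁ p₂ h).deriv]

theorem hasPoissonBracket_aFun_p₂ (h : u₁ ≠ u₂) :
    HasPoissonBracket aFun (fun _ _ _ y => y)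
      (-((3 * u₂ ^ 2 + aFun u₁ u₂ p₁ p₂) / (u₂ - u₁))) u₁ u₂ p₁ p₂ := by
  refine ⟨by fun_prop, by fun_prop, by fun_prop, by fun_prop, ?_⟩
  simp [poissonBracket, (hasDerivAt_aFun_u₂ p₁ p₂ h).deriv]

variable {p₁}

theorem hasPoissonBracket_aFun_lam₁Fun (h : u₁ ≠ u₂) (hp₁ : p₁ ≠ 0) :
    HasPoissonBracket aFun lam₁Fun
      ((3 * u₁ - lam₁Fun u₁ u₂ p₁ p₂ ^ 2) / (u₂ - u₁)) u₁ u₂ p₁ p₂ := by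
  have h₂ : u₂ - u₁ ≠ 0 := sub_ne_zero.2 h.symm
  refine ((((HasPoissonBracket.const 3).mul (hasPoissonBracket_aFun_u₁ p₁ p₂ h).sq).add
    (hasPoissonBracket_aFun_self p₁ p₂ h)).div (hasPoissonBracket_aFun_p₁ p₁ p₂ h)
    hp₁).congr_value ?_
  simp only [lam₁Fun]
  field_simp
  ring

theorem hasPoissonBracket_aFun_x'Fun (h : u₁ ≠ u₂) (hp₁ : p₁ ≠ 0) :
    HasPoissonBracket aFun x'Fun (2 * y'Fun u₁ u₂ p₁ p₂ / (u₂ - u₁)) u₁ u₂ p₁ p₂ := by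
  refine ((hasPoissonBracket_aFun_lam₁Fun p₂ h hp₁).sq.sub ((HasPoissonBracket.const 2).mul
    (hasPoissonBracket_aFun_u₁ p₁ p₂ h))).congr_value ?_
  simp only [y'Fun, x'Fun]
  ring

theorem lam₁Fun_mul (hp₁ : p₁ ≠ 0) :
    lam₁Fun u₁ u₂ p₁ p₂ * p₁ = 3 * u₁ ^ 2 + aFun u₁ u₂ p₁ p₂ :=
  div_mul_cancel₀ _ hp₁

theorem hasPoissonBracket_aFun_y'Fun (h : u₁ ≠ u₂) (hp₁ : p₁ ≠ 0) :
    HasPoissonBracket aFun y'Fun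
      ((3 * x'Fun u₁ u₂ p₁ p₂ ^ 2 + aFun u₁ u₂ p₁ p₂) / (u₂ - u₁)) u₁ u₂ p₁ p₂ := by
  have h₂ : u₂ - u₁ ≠ 0 := sub_ne_zero.2 h.symm
  refine (((hasPoissonBracket_aFun_p₁ p₁ p₂ h).div (.const 2) two_ne_zero).add
    ((hasPoissonBracket_aFun_lam₁Fun p₂ h hp₁).mul ((hasPoissonBracket_aFun_x'Fun p₂ h hp₁).sub
    (hasPoissonBracket_aFun_u₁ p₁ p₂ h)))).neg.congr_value ?_
  have ha : aFun u₁ u₂ p₁ p₂ = lam₁Fun u₁ u₂ p₁ p₂ * p₁ - 3 * u₁ ^ 2 := by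
    rw [lam₁Fun_mul p₂ hp₁]; ring
  simp only [y'Fun, x'Fun, ha]
  field_simp
  ring

/-- Subtracting the two Weierstrass equations satisfied by `P₁` and `P₂`. -/
theorem sq_sub_sq_eq (h : u₁ ≠ u₂) :
    (p₁ / 2) ^ 2 - p₂ ^ 2 = u₁ ^ 3 - u₂ ^ 3 + aFun u₁ u₂ p₁ p₂ * (u₁ - u₂) := by
  have h₁ : u₁ - u₂ ≠ 0 := sub_ne_zero.2 h
  rw [aFun, ← neg_sub u₁ u₂]
  field_simp
  ring

/-- Subtracting the two Weierstrass equations satisfied by `[2]P₁` and `P₂`. -/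
theorem y'Fun_sq_sub_sq_eq (h : u₁ ≠ u₂) (hp₁ : p₁ ≠ 0) :
    y'Fun u₁ u₂ p₁ p₂ ^ 2 - p₂ ^ 2 = x'Fun u₁ u₂ p₁ p₂ ^ 3 - u₂ ^ 3 +
      aFun u₁ u₂ p₁ p₂ * (x'Fun u₁ u₂ p₁ p₂ - u₂) := by
  have hy := sq_sub_sq_eq (p₁ := p₁) p₂ h
  have hl := lam₁Fun_mul (u₁ := u₁) (u₂ := u₂) p₂ hp₁
  simp only [y'Fun, x'Fun]
  linear_combination hy + (lam₁Fun u₁ u₂ p₁ p₂ ^ 2 - 3 * u₁) * hl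

theorem hasPoissonBracket_aFun_x₃Fun (h : u₁ ≠ u₂) (hp₁ : p₁ ≠ 0)
    (hx' : x'Fun u₁ u₂ p₁ p₂ ≠ u₂) :
    HasPoissonBracket aFun x₃Fun 0 u₁ u₂ p₁ p₂ := by
  have h₂ : u₂ - u₁ ≠ 0 := sub_ne_zero.2 h.symm
  have h₃ : x'Fun u₁ u₂ p₁ p₂ - u₂ ≠ 0 := sub_ne_zero.2 hx'
  have hX := hasPoissonBracket_aFun_x'Fun p₂ h hp₁
  have hu₂ := hasPoissonBracket_aFun_u₂ (u₁ := u₁) (u₂ := u₂) p₁ p₂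
  have hlam₂ := ((hasPoissonBracket_aFun_y'Fun p₂ h hp₁).sub
    (hasPoissonBracket_aFun_p₂ p₁ p₂ h)).div (hX.sub hu₂) h₃
  refine ((hlam₂.sq.sub hX).sub hu₂).congr_value ?_
  have hc := y'Fun_sq_sub_sq_eq p₂ h hp₁
  generalize y'Fun u₁ u₂ p₁ p₂ = Y at *
  generalize x'Fun u₁ u₂ p₁ p₂ = X at *
  generalize aFun u₁ u₂ p₁ p₂ = A at *
  field_simp
  linear_combination (-4 * (Y - p₂)) * hc

end aFun

/-- For `n = 2`, `m = 1` the abscissa `x₃` of `[2]P₁ + P₂`, obtained by the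
tangent–chord process, is an additional first integral of the Hamiltonian
system with Hamiltonian `H = a`: `{a, x₃} = 0`. -/
theorem x₃_first_integral_n2_m1 (u₁ u₂ p₁ p₂ : ℝ) (h : u₁ ≠ u₂) (hp₁ : p₁ ≠ 0)
    (hx' : x'Fun u₁ u₂ p₁ p₂ ≠ u₂) :
    poissonBracket aFun x₃Fun u₁ u₂ p₁ p₂ = 0 :=
  (hasPoissonBracket_aFun_x₃Fun p₂ h hp₁ hx').2.2.2.2
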